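/- arXiv:1011.2433 — 3 statements merged into one kernel-verified Lean document; each statement's English description precedes it below -/
import Mathlib

section
/- Let H be an n×n complex Hankel matrix and let P_n be the n×n lower triangular Pascal matrix. Then P_n · H · P_n^T is again a Hankel matrix. -/
open Matrix

/-- The `n×n` lower triangular Pascal matrix over `ℂ`. -/
def pascal (n : ℕ) : Matrix (Fin n) (Fin n) ℂ :=
  Matrix.of fun i j : Fin n =>
    if (j : ℕ) ≤ (i : ℕ) then ((i : ℕ).choose (j : ℕ) : ℂ) else 0

theorem pascal_apply {n : ℕ} (i j : Fin n) :
    pascal n i j = ((i : ℕ).choose (j : ℕ) : ℂ) := by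
  simp only [pascal, Matrix.of_apply]
  split_ifs with h
  · rfl
  · rw [Nat.choose_eq_zero_of_lt (not_le.mp h), Nat.cast_zero]

/-- Row `i` of the Pascal matrix lists the coefficients of `(X + 1) ^ i`. -/
theorem X_add_one_pow_eq_sum_pascal {n : ℕ} (i : Fin n) :
    (Polynomial.X + 1 : Polynomial ℂ) ^ (i : ℕ) =
      ∑ a : Fin n, pascal n i a • Polynomial.X ^ (a : ℕ) := by
  simp only [pascal_apply]
  rw [Fin.sum_univ_eq_sum_range
    (fun a => ((i : ℕ).choose a : ℂ) • (Polynomial.X : Polynomial ℂ) ^ a) n, add_pow]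
  refine (Finset.sum_subset (Finset.range_subset_range.mpr i.isLt) fun a _ ha => ?_).trans
    (Finset.sum_congr rfl fun a _ => ?_)
  · rw [Nat.choose_eq_zero_of_lt (by simpa [Nat.lt_succ_iff] using ha)]
    simp
  · rw [one_pow, mul_one, mul_comm, Polynomial.smul_eq_C_mul, Polynomial.C_eq_natCast]

theorem exists_seq_of_isHankel {n : ℕ} (H : Matrix (Fin n) (Fin n) ℂ)
    (hH : ∀ i j k l : Fin n, (i : ℕ) + (j : ℕ) = (k : ℕ) + (l : ℕ) → H i j = H k l) :
    ∃ h : ℕ → ℂ, ∀ i j : Fin n, H i j = h (i + j) := by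
  classical
  refine ⟨fun m => if hm : ∃ p : Fin n × Fin n, (p.1 : ℕ) + p.2 = m then
    H hm.choose.1 hm.choose.2 else 0, fun i j => ?_⟩
  have hm : ∃ p : Fin n × Fin n, (p.1 : ℕ) + p.2 = i + j := ⟨(i, j), rfl⟩
  beta_reduce
  rw [dif_pos hm]
  exact hH _ _ _ _ hm.choose_spec.symm

/-- If `H i j = L (X ^ (i + j))`, then conjugating by the Pascal matrix replaces `X` by `X + 1`. -/
theorem pascal_mul_mul_transpose_apply {n : ℕ} (H : Matrix (Fin n) (Fin n) ℂ)
    (L : Polynomial ℂ →ₗ[ℂ] ℂ) (hL : ∀ i j : Fin n, H i j = L (Polynomial.X ^ ((i : ℕ) + j)))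
    (i j : Fin n) :
    (pascal n * H * (pascal n)ᵀ) i j = L ((Polynomial.X + 1) ^ ((i : ℕ) + j)) := by
  rw [pow_add, X_add_one_pow_eq_sum_pascal i, X_add_one_pow_eq_sum_pascal j,
    Finset.sum_mul_sum, Finset.sum_comm]
  simp only [Matrix.mul_apply, Matrix.transpose_apply, map_sum, smul_mul_smul_comm, ← pow_add,
    map_smul, ← hL, smul_eq_mul, Finset.sum_mul]
  exact Finset.sum_congr rfl fun b _ => Finset.sum_congr rfl fun a _ => by ring

/-- If `H` is an `n×n` complex Hankel matrix (its `(i,j)` entry depends only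
on `i+j`), then `P_n · H · P_nᵀ` is again a Hankel matrix. -/
theorem pascal_mul_hankel_mul_pascal_transpose_isHankel
    (n : ℕ) (H : Matrix (Fin n) (Fin n) ℂ)
    (hH : ∀ i j k l : Fin n, (i : ℕ) + (j : ℕ) = (k : ℕ) + (l : ℕ) → H i j = H k l) :
    ∀ i j k l : Fin n, (i : ℕ) + (j : ℕ) = (k : ℕ) + (l : ℕ) →
      (pascal n * H * (pascal n)ᵀ) i j = (pascal n * H * (pascal n)ᵀ) k l := by
  intro i j k l hijkl
  obtain ⟨h, hh⟩ := exists_seq_of_isHankel H hH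
  have hL : ∀ i j : Fin n, H i j =
      Polynomial.lsum (fun m => h m • (LinearMap.id : ℂ →ₗ[ℂ] ℂ))
        (Polynomial.X ^ ((i : ℕ) + j)) := fun i j => by
    simp [hh, Polynomial.lsum_apply, Polynomial.X_pow_eq_monomial, Polynomial.sum_monomial_index]
  rw [pascal_mul_mul_transpose_apply H _ hL, pascal_mul_mul_transpose_apply H _ hL, hijkl]
end

section
/- Let n = 2m - 1 with m an integer greater than 1, and let B(s) = (b_1(s), b_2(s))^T be the Bézier curve of degree n-1 determined by n control points Q_0 = (x_0, y_0), ..., Q_{n-1} = (x_{n-1}, y_{n-1}) in R^2. Then for every s ∈ [0,1], b_1(s) = e_m^T B_m^e(s) H_x (B_m^e(s))^T e_m and b_2(s) = e_m^T B_m^e(s) H_y (B_m^e(s))^T e_m, where H_x and H_y are the m×m Hankel matrices with (H_x)_{ij} = x_{i+j-2} and (H_y)_{ij} = y_{i+j-2} for 1 ≤ i,j ≤ m. -/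
open Matrix

/-- The `m×m` Bernstein matrix `B_m^e(s)`. -/
def bernsteinMat (m : ℕ) (s : ℝ) : Matrix (Fin m) (Fin m) ℝ :=
  Matrix.of fun i j : Fin m =>
    if (j : ℕ) ≤ (i : ℕ) then
      ((i : ℕ).choose (j : ℕ) : ℝ) * s ^ (j : ℕ) * (1 - s) ^ ((i : ℕ) - (j : ℕ))
    else 0

open Polynomial in
/-- The binomial expansion of `(s X + t) ^ p` in monomials. -/
theorem C_mul_X_add_C_pow_eq_sum_monomial {R : Type*} [CommSemiring R] (s t : R) (p : ℕ) :
    (C s * X + C t) ^ p =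
      ∑ i ∈ Finset.range (p + 1),
        monomial i ((p.choose i : R) * s ^ i * t ^ (p - i)) := by
  rw [add_pow]
  refine Finset.sum_congr rfl fun i _ => ?_
  rw [← C_mul_X_pow_eq_monomial]
  simp only [map_mul, map_pow, map_natCast]
  ring

open Polynomial in
/-- A binomially weighted sum of degree `p + q` splits as a double sum of degrees `p` and `q`:
a weighted form of Vandermonde's identity. -/
theorem sum_choose_add_mul_eq_sum_sum {R : Type*} [CommSemiring R] (s t : R) (p q : ℕ)
    (f : ℕ → R) :
    ∑ k ∈ Finset.range (p + q + 1),
        ((p + q).choose k : R) * s ^ k * t ^ (p + q - k) * f k =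
      ∑ i ∈ Finset.range (p + 1), ∑ j ∈ Finset.range (q + 1),
        ((p.choose i : R) * s ^ i * t ^ (p - i)) *
          ((q.choose j : R) * s ^ j * t ^ (q - j)) * f (i + j) := by
  let L : R[X] →ₗ[R] R := Polynomial.lsum fun k => LinearMap.mulRight R (f k)
  have hL (k : ℕ) (a : R) : L (monomial k a) = a * f k := by
    simp [L, Polynomial.lsum_apply, Polynomial.sum_monomial_index]
  have h := congrArg L (pow_add (C s * X + C t) p q)
  simpa only [C_mul_X_add_C_pow_eq_sum_monomial, Finset.sum_mul_sum, monomial_mul_monomial,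
    map_sum, hL] using h

/-- A coordinate of a Bézier curve of degree `2 * p` is a quadratic form in the last row of the
Bernstein matrix, whose matrix is the Hankel matrix of the control values. -/
theorem sum_bernstein_eq_bernsteinMat_mul_hankel (p : ℕ) (f : ℕ → ℝ) (s : ℝ) :
    ∑ k ∈ Finset.range (2 * p + 1),
        ((2 * p).choose k : ℝ) * s ^ k * (1 - s) ^ (2 * p - k) * f k =
      (bernsteinMat (p + 1) s *
        (Matrix.of fun i j : Fin (p + 1) => f ((i : ℕ) + (j : ℕ))) *
        (bernsteinMat (p + 1) s)ᵀ) (Fin.last p) (Fin.last p) := by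
  have hrow (j : Fin (p + 1)) : bernsteinMat (p + 1) s (Fin.last p) j =
      (p.choose j : ℝ) * s ^ (j : ℕ) * (1 - s) ^ (p - (j : ℕ)) := by
    simp [bernsteinMat, -Fin.val_fin_le, Nat.lt_succ_iff.mp j.is_lt]
  rw [two_mul, sum_choose_add_mul_eq_sum_sum, Finset.sum_comm]
  simp only [Matrix.mul_apply, Matrix.transpose_apply, Matrix.of_apply, hrow, Finset.sum_range,
    Finset.sum_mul]
  exact Finset.sum_congr rfl fun j _ => Finset.sum_congr rfl fun i _ => by ring

/-- Let `n = 2m - 1`, `m > 1`, and let `B(s) = (b₁(s), b₂(s))ᵀ` be the Bézier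
curve of degree `n-1` with control points `(x_i, y_i)`, `i = 0, ..., n-1`.  Then for every
`s ∈ [0,1]`, `b₁(s) = e_mᵀ B_m^e(s) H_x (B_m^e(s))ᵀ e_m` and
`b₂(s) = e_mᵀ B_m^e(s) H_y (B_m^e(s))ᵀ e_m`, where `(H_x)_{ij} = x_{i+j-2}`,
`(H_y)_{ij} = y_{i+j-2}`. -/
theorem bezier_as_hankel_form
    (m : ℕ) (hm : 1 < m) (n : ℕ) (hn : n = 2 * m - 1)
    (x y : Fin n → ℝ) (s : ℝ) (hs : s ∈ Set.Icc (0 : ℝ) 1) :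
    (∑ i : Fin n, ((n - 1).choose (i : ℕ) : ℝ) * s ^ (i : ℕ) * (1 - s) ^ (n - 1 - (i : ℕ)) * x i =
      (bernsteinMat m s *
        (Matrix.of fun i j : Fin m => x ⟨(i : ℕ) + (j : ℕ), by omega⟩) *
        (bernsteinMat m s)ᵀ) ⟨m - 1, by omega⟩ ⟨m - 1, by omega⟩) ∧
    (∑ i : Fin n, ((n - 1).choose (i : ℕ) : ℝ) * s ^ (i : ℕ) * (1 - s) ^ (n - 1 - (i : ℕ)) * y i =
      (bernsteinMat m s *
        (Matrix.of fun i j : Fin m => y ⟨(i : ℕ) + (j : ℕ), by omega⟩) *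
        (bernsteinMat m s)ᵀ) ⟨m - 1, by omega⟩ ⟨m - 1, by omega⟩) := by
  obtain ⟨p, rfl⟩ : ∃ p, m = p + 1 := ⟨m - 1, by omega⟩
  obtain rfl : n = 2 * p + 1 := by omega
  have key (z : Fin (2 * p + 1) → ℝ) :
      ∑ i : Fin (2 * p + 1), ((2 * p).choose (i : ℕ) : ℝ) * s ^ (i : ℕ) *
          (1 - s) ^ (2 * p - (i : ℕ)) * z i =
        (bernsteinMat (p + 1) s *
          (Matrix.of fun i j : Fin (p + 1) => z ⟨(i : ℕ) + (j : ℕ), by omega⟩) *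
          (bernsteinMat (p + 1) s)ᵀ) (Fin.last p) (Fin.last p) := by
    have h := sum_bernstein_eq_bernsteinMat_mul_hankel p
      (fun k => if hk : k < 2 * p + 1 then z ⟨k, hk⟩ else 0) s
    have hlt (i j : Fin (p + 1)) : (i : ℕ) + (j : ℕ) < 2 * p + 1 := by omega
    simpa only [Finset.sum_range, Fin.is_lt, hlt, dite_true, Fin.eta] using h
  exact ⟨key x, key y⟩
end

section
/- Let n = 2m - 1 with m ≥ 1, let x = (x_0, ..., x_{n-1})^T ∈ C^n, and let H_x be the m×m Hankel matrix with (H_x)_{ij} = x_{i+j-2}. Let a = P_n x, where P_n is the n×n lower triangular Pascal matrix and a = (a_0, ..., a_{n-1})^T. Then (P_m H_x P_m^T)_{ij} = a_{i+j-2} for all 1 ≤ i,j ≤ m. -/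
open Matrix

/-- The `k×k` lower triangular Pascal matrix over `ℂ`. -/
def pascalMat (k : ℕ) : Matrix (Fin k) (Fin k) ℂ :=
  Matrix.of fun i j : Fin k =>
    if (j : ℕ) ≤ (i : ℕ) then ((i : ℕ).choose (j : ℕ) : ℂ) else 0

theorem pascalMat_apply (k : ℕ) (i j : Fin k) :
    pascalMat k i j = ((i : ℕ).choose (j : ℕ) : ℂ) := by
  simp only [pascalMat, Matrix.of_apply]
  split_ifs with h
  · rfl
  · rw [Nat.choose_eq_zero_of_lt (not_le.mp h), Nat.cast_zero]

/-- The shift operator on sequences. -/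
def seqShift : Module.End ℂ (ℕ → ℂ) := LinearMap.funLeft ℂ ℂ Nat.succ

theorem seqShift_pow_apply (k : ℕ) (y : ℕ → ℂ) (s : ℕ) :
    (seqShift ^ k) y s = y (k + s) := by
  induction k generalizing s with
  | zero => simp
  | succ k ih =>
    rw [pow_succ', Module.End.mul_apply, seqShift, LinearMap.funLeft_apply, ← seqShift, ih]
    congr 1
    omega

theorem seqShift_add_one_pow_apply {N i : ℕ} (hi : i < N) (y : ℕ → ℂ) (s : ℕ) :
    ((seqShift + 1) ^ i) y s = ∑ k : Fin N, (i.choose k : ℂ) * y (k + s) := by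
  rw [Fin.sum_univ_eq_sum_range (fun k => (i.choose k : ℂ) * y (k + s)) N,
    ← Finset.sum_subset (Finset.range_subset_range.mpr hi), (Commute.one_right seqShift).add_pow,
    LinearMap.sum_apply, Finset.sum_apply]
  · refine Finset.sum_congr rfl fun k _ => ?_
    rw [one_pow, mul_one, ← Nat.cast_comm, ← nsmul_eq_mul, LinearMap.smul_apply, Pi.smul_apply,
      seqShift_pow_apply, nsmul_eq_mul]
  · intro k _ hk
    rw [Nat.choose_eq_zero_of_lt (by simpa using hk), Nat.cast_zero, zero_mul]

/-- Let `n = 2m - 1`, `m ≥ 1`, `x ∈ ℂⁿ` and let `H_x` be the `m×m` Hankel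
matrix with `(H_x)_{ij} = x_{i+j-2}`.  If `a = P_n x`, then
`(P_m H_x P_mᵀ)_{ij} = a_{i+j-2}` for all `i, j`. -/
theorem pascal_hankel_pascal_transpose_entries
    (m : ℕ) (hm : 0 < m) (n : ℕ) (hn : n = 2 * m - 1)
    (x : Fin n → ℂ) (a : Fin n → ℂ) (ha : a = pascalMat n *ᵥ x) (i j : Fin m) :
    (pascalMat m * (Matrix.of fun i j : Fin m => x ⟨(i : ℕ) + (j : ℕ), by omega⟩) *
      (pascalMat m)ᵀ) i j = a ⟨(i : ℕ) + (j : ℕ), by omega⟩ := by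
  subst ha
  let y : ℕ → ℂ := fun k => if h : k < n then x ⟨k, h⟩ else 0
  have hy (k : ℕ) (h : k < n) : x ⟨k, h⟩ = y k := by simp [y, h]
  have hmul : ((seqShift + 1) ^ (i + j : ℕ)) y 0
      = ((seqShift + 1) ^ (j : ℕ)) (((seqShift + 1) ^ (i : ℕ)) y) 0 := by
    rw [add_comm (i : ℕ), pow_add, Module.End.mul_apply]
  rw [seqShift_add_one_pow_apply (N := n) (by omega), seqShift_add_one_pow_apply j.isLt] at hmul
  simp only [seqShift_add_one_pow_apply i.isLt, add_zero] at hmul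
  simp only [Matrix.mulVec, dotProduct, pascalMat_apply]
  refine Eq.trans ?_ (hmul.symm.trans ?_)
  · simp only [Matrix.mul_apply, Matrix.transpose_apply, Matrix.of_apply, pascalMat_apply, hy]
    exact Finset.sum_congr rfl fun l _ => mul_comm _ _
  · exact Finset.sum_congr rfl fun k _ => by rw [← hy k k.isLt]
end
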